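/- arXiv:2210.03708 — 3 statements merged into one kernel-verified Lean document; each statement's English description precedes it below -/
import Mathlib

section
/- Let A be a complex Banach algebra and I a closed two-sided ideal of A. If A is cyclically weakly amenable, then the quotient Banach algebra A/I is cyclically weakly amenable. -/
/-- `D : A → A*` (a continuous linear map into the dual) is a *derivation* when
`D(ab) = D(a)·b + a·D(b)`, where `A*` is an `A`-bimodule via `(F·a)(x) = F(ax)` and
`(a·F)(x) = F(xa)`; pairing against `x : A` gives the condition below. -/
def IsDerivation {A : Type*} [NonUnitalNormedRing A] [NormedSpace ℂ A]
    (D : A →L[ℂ] (A →L[ℂ] ℂ)) : Prop :=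
  ∀ a b x : A, D (a * b) x = D a (b * x) + D b (x * a)

/-- A map `D : A → A*` is *cyclic* when `⟨D(a), b⟩ + ⟨D(b), a⟩ = 0` for all `a, b`. -/
def IsCyclicMap {A : Type*} [NonUnitalNormedRing A] [NormedSpace ℂ A]
    (D : A →L[ℂ] (A →L[ℂ] ℂ)) : Prop :=
  ∀ a b : A, D a b + D b a = 0

/-- `D : A → A*` is *inner* if `D = ad_F` for some `F ∈ A*`, where
`ad_F(a) = F·a - a·F`, i.e. `⟨ad_F(a), x⟩ = F(ax) - F(xa)`. -/
def IsInnerDerivation {A : Type*} [NonUnitalNormedRing A] [NormedSpace ℂ A]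
    (D : A →L[ℂ] (A →L[ℂ] ℂ)) : Prop :=
  ∃ F : A →L[ℂ] ℂ, ∀ a x : A, D a x = F (a * x) - F (x * a)

/-- A Banach algebra `A` is *cyclically weakly amenable* if every continuous derivation
from `A` into `A*` is cyclic. -/
def CyclicallyWeaklyAmenable (A : Type*) [NonUnitalNormedRing A] [NormedSpace ℂ A] : Prop :=
  ∀ D : A →L[ℂ] (A →L[ℂ] ℂ), IsDerivation D → IsCyclicMap D

/-- A Banach algebra `A` is *weakly amenable* if every continuous derivation
from `A` into `A*` is inner. -/
def WeaklyAmenable (A : Type*) [NonUnitalNormedRing A] [NormedSpace ℂ A] : Prop :=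
  ∀ D : A →L[ℂ] (A →L[ℂ] ℂ), IsDerivation D → IsInnerDerivation D

/-- A Banach algebra `A` is *cyclically amenable* if every continuous cyclic derivation
from `A` into `A*` is inner. -/
def CyclicallyAmenable (A : Type*) [NonUnitalNormedRing A] [NormedSpace ℂ A] : Prop :=
  ∀ D : A →L[ℂ] (A →L[ℂ] ℂ), IsDerivation D → IsCyclicMap D → IsInnerDerivation D

set_option linter.unusedSectionVars false

section QuotientBanachAlgebra

variable {A : Type*} [NonUnitalNormedRing A] [NormedSpace ℂ A]
  [IsScalarTower ℂ A A] [SMulCommClass ℂ A A]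

/-- The multiplication induced on the quotient `A ⧸ I` by a two-sided ideal `I`. -/
noncomputable def quotMul (I : Submodule ℂ A)
    (hl : ∀ a b : A, b ∈ I → a * b ∈ I) (hr : ∀ a b : A, a ∈ I → a * b ∈ I)
    (x y : A ⧸ I) : A ⧸ I :=
  Quotient.liftOn₂' x y (fun a b => Submodule.Quotient.mk (a * b)) (by
    intro a₁ b₁ a₂ b₂ h₁ h₂
    have e₁ : (Submodule.Quotient.mk a₁ : A ⧸ I) = Submodule.Quotient.mk a₂ := Quotient.sound' h₁
    have e₂ : (Submodule.Quotient.mk b₁ : A ⧸ I) = Submodule.Quotient.mk b₂ := Quotient.sound' h₂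
    rw [Submodule.Quotient.eq] at e₁ e₂
    refine (Submodule.Quotient.eq I).mpr ?_
    have key : a₁ * b₁ - a₂ * b₂ = a₁ * (b₁ - b₂) + (a₁ - a₂) * b₂ := by
      rw [mul_sub, sub_mul]; abel
    rw [key]
    exact I.add_mem (hl _ _ e₂) (hr _ _ e₁))

lemma quotMul_mk (I : Submodule ℂ A)
    (hl : ∀ a b : A, b ∈ I → a * b ∈ I) (hr : ∀ a b : A, a ∈ I → a * b ∈ I) (a b : A) :
    quotMul I hl hr (Submodule.Quotient.mk a) (Submodule.Quotient.mk b) =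
      Submodule.Quotient.mk (a * b) := rfl

lemma quot_norm_mul_le (I : Submodule ℂ A)
    (hl : ∀ a b : A, b ∈ I → a * b ∈ I) (hr : ∀ a b : A, a ∈ I → a * b ∈ I)
    (x y : A ⧸ I) : ‖quotMul I hl hr x y‖ ≤ ‖x‖ * ‖y‖ := by
  refine le_of_forall_pos_le_add fun ε hε => ?_
  have hx0 := norm_nonneg x
  have hy0 := norm_nonneg y
  have hden : (0:ℝ) < ‖x‖ + ‖y‖ + 1 := by linarith
  set δ : ℝ := min 1 (ε / (‖x‖ + ‖y‖ + 1)) with hδdef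
  have hδpos : 0 < δ := lt_min one_pos (div_pos hε hden)
  have hδ1 : δ ≤ 1 := min_le_left _ _
  obtain ⟨a, ha, hna⟩ := Submodule.Quotient.norm_mk_lt x hδpos
  obtain ⟨b, hb, hnb⟩ := Submodule.Quotient.norm_mk_lt y hδpos
  have key : quotMul I hl hr x y = (Submodule.Quotient.mk (a * b) : A ⧸ I) := by
    rw [← ha, ← hb, quotMul_mk]
  have h1 : ‖quotMul I hl hr x y‖ ≤ ‖a‖ * ‖b‖ := by
    rw [key]
    exact (Submodule.Quotient.norm_mk_le I (a * b)).trans (norm_mul_le a b)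
  have h2 : ‖a‖ * ‖b‖ ≤ (‖x‖ + δ) * (‖y‖ + δ) :=
    mul_le_mul hna.le hnb.le (norm_nonneg b) (by linarith)
  have h3 : δ * (‖x‖ + ‖y‖ + 1) ≤ ε := by
    calc δ * (‖x‖ + ‖y‖ + 1) ≤ (ε / (‖x‖ + ‖y‖ + 1)) * (‖x‖ + ‖y‖ + 1) := by
          gcongr
          exact min_le_right _ _
      _ = ε := div_mul_cancel₀ ε hden.ne'
  have h4 : (‖x‖ + δ) * (‖y‖ + δ) ≤ ‖x‖ * ‖y‖ + ε := by nlinarith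
  linarith

/-- The quotient of a complex Banach algebra by a closed two-sided ideal `I`, as a
(non-unital) normed ring: the underlying normed space is the quotient normed space
`A ⧸ I` (with the quotient norm) and the multiplication is induced from `A`. -/
@[reducible] noncomputable def quotientNonUnitalNormedRing (I : Submodule ℂ A) (hcl : IsClosed (I : Set A))
    (hl : ∀ a b : A, b ∈ I → a * b ∈ I) (hr : ∀ a b : A, a ∈ I → a * b ∈ I) :
    NonUnitalNormedRing (A ⧸ I) :=
  haveI := hcl
  { (inferInstance : NormedAddCommGroup (A ⧸ I)) with
    mul := quotMul I hl hr
    left_distrib := fun x y z => by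
      obtain ⟨a, rfl⟩ := Submodule.Quotient.mk_surjective I x
      obtain ⟨b, rfl⟩ := Submodule.Quotient.mk_surjective I y
      obtain ⟨c, rfl⟩ := Submodule.Quotient.mk_surjective I z
      show quotMul I hl hr _ _ = quotMul I hl hr _ _ + quotMul I hl hr _ _
      rw [← Submodule.Quotient.mk_add, quotMul_mk, quotMul_mk, quotMul_mk,
        ← Submodule.Quotient.mk_add, mul_add]
    right_distrib := fun x y z => by
      obtain ⟨a, rfl⟩ := Submodule.Quotient.mk_surjective I x
      obtain ⟨b, rfl⟩ := Submodule.Quotient.mk_surjective I y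
      obtain ⟨c, rfl⟩ := Submodule.Quotient.mk_surjective I z
      show quotMul I hl hr _ _ = quotMul I hl hr _ _ + quotMul I hl hr _ _
      rw [← Submodule.Quotient.mk_add, quotMul_mk, quotMul_mk, quotMul_mk,
        ← Submodule.Quotient.mk_add, add_mul]
    zero_mul := fun x => by
      obtain ⟨a, rfl⟩ := Submodule.Quotient.mk_surjective I x
      show quotMul I hl hr 0 _ = 0
      rw [← Submodule.Quotient.mk_zero I, quotMul_mk, zero_mul]
    mul_zero := fun x => by
      obtain ⟨a, rfl⟩ := Submodule.Quotient.mk_surjective I x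
      show quotMul I hl hr _ 0 = 0
      rw [← Submodule.Quotient.mk_zero I, quotMul_mk, mul_zero]
    mul_assoc := fun x y z => by
      obtain ⟨a, rfl⟩ := Submodule.Quotient.mk_surjective I x
      obtain ⟨b, rfl⟩ := Submodule.Quotient.mk_surjective I y
      obtain ⟨c, rfl⟩ := Submodule.Quotient.mk_surjective I z
      show quotMul I hl hr (quotMul I hl hr _ _) _ = quotMul I hl hr _ (quotMul I hl hr _ _)
      rw [quotMul_mk, quotMul_mk, quotMul_mk, quotMul_mk, mul_assoc]
    dist_eq := dist_eq_norm_neg_add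
    norm_mul_le := quot_norm_mul_le I hl hr }

end QuotientBanachAlgebra

/-- Cyclic weak amenability passes to the image of a surjective continuous homomorphism. -/
theorem CyclicallyWeaklyAmenable.of_surjective {A B : Type*}
    [NonUnitalNormedRing A] [NormedSpace ℂ A] [NonUnitalNormedRing B] [NormedSpace ℂ B]
    (φ : A →L[ℂ] B) (hmul : ∀ a b : A, φ (a * b) = φ a * φ b)
    (hsurj : Function.Surjective φ) (h : CyclicallyWeaklyAmenable A) :
    CyclicallyWeaklyAmenable B := by
  intro D hD
  let E : A →L[ℂ] (A →L[ℂ] ℂ) := D.bilinearComp φ φ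
  have hE : ∀ a x, E a x = D (φ a) (φ x) := fun _ _ => rfl
  have hEder : IsDerivation E := fun a b x => by
    simp only [hE, hmul]
    exact hD _ _ _
  intro x y
  obtain ⟨a, rfl⟩ := hsurj x
  obtain ⟨b, rfl⟩ := hsurj y
  exact h E hEder a b

/-- If a complex Banach algebra `A` is cyclically weakly amenable and `I` is a closed
two-sided ideal of `A`, then the quotient Banach algebra `A ⧸ I` (with the quotient norm
and induced multiplication) is cyclically weakly amenable. -/
theorem cyclicallyWeaklyAmenable_quotient {A : Type*}
    [NonUnitalNormedRing A] [NormedSpace ℂ A] [IsScalarTower ℂ A A]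
    [SMulCommClass ℂ A A] [CompleteSpace A]
    (I : Submodule ℂ A) (hcl : IsClosed (I : Set A))
    (hl : ∀ a b : A, b ∈ I → a * b ∈ I) (hr : ∀ a b : A, a ∈ I → a * b ∈ I)
    (h : CyclicallyWeaklyAmenable A) :
    letI : NonUnitalNormedRing (A ⧸ I) := quotientNonUnitalNormedRing I hcl hl hr
    CyclicallyWeaklyAmenable (A ⧸ I) := by
  let : NonUnitalNormedRing (A ⧸ I) := quotientNonUnitalNormedRing I hcl hl hr
  let π : A →L[ℂ] A ⧸ I :=
    I.mkQ.mkContinuous 1 fun a => by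
      rw [one_mul]
      exact Submodule.Quotient.norm_mk_le I a
  exact h.of_surjective π (fun _ _ => rfl) (Submodule.Quotient.mk_surjective I)
end

section
/- Let A₁ and A₂ be complex Banach algebras and let A₁ ⊕ A₂ denote their direct sum, the Banach algebra on the Cartesian product with coordinatewise operations and norm ‖(a₁,a₂)‖ = ‖a₁‖ + ‖a₂‖. Then A₁ ⊕ A₂ is 0-point amenable if and only if both A₁ and A₂ are 0-point amenable. -/
/-- A continuous linear functional `φ` on `A` is *multiplicative* when `φ(ab) = φ(a)φ(b)`.
The nonzero such functionals are the characters of `A` (the set `Δ(A)`); together with `0`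
they form `Δ₀(A)`. -/
def IsMulFunctional {A : Type*} [NonUnitalNormedRing A] [NormedSpace ℂ A]
    (φ : A →L[ℂ] ℂ) : Prop :=
  ∀ a b : A, φ (a * b) = φ a * φ b

/-- `d ∈ A*` is a *continuous point derivation* of `A` at `φ` when
`d(ab) = d(a)φ(b) + φ(a)d(b)` for all `a, b ∈ A`. -/
def IsPointDerivationAt {A : Type*} [NonUnitalNormedRing A] [NormedSpace ℂ A]
    (φ d : A →L[ℂ] ℂ) : Prop :=
  ∀ a b : A, d (a * b) = d a * φ b + φ a * d b

/-- `A` is *0-point amenable* if the only continuous point derivation of `A` at any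
`φ ∈ Δ₀(A)` (i.e. any multiplicative functional, zero allowed) is zero. -/
def ZeroPointAmenable (A : Type*) [NonUnitalNormedRing A] [NormedSpace ℂ A] : Prop :=
  ∀ φ d : A →L[ℂ] ℂ, IsMulFunctional φ → IsPointDerivationAt φ d → d = 0

/-- `A` is *point amenable* if the only continuous point derivation of `A` at any character
`φ ∈ Δ(A)` (i.e. any nonzero multiplicative functional) is zero. -/
def PointAmenable (A : Type*) [NonUnitalNormedRing A] [NormedSpace ℂ A] : Prop :=
  ∀ φ d : A →L[ℂ] ℂ, IsMulFunctional φ → φ ≠ 0 → IsPointDerivationAt φ d → d = 0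

namespace L1Prod

variable {α β : Type*} [NonUnitalNormedRing α] [NonUnitalNormedRing β]

noncomputable instance : NonUnitalRing (WithLp 1 (α × β)) :=
  { (inferInstance : AddCommGroup (WithLp 1 (α × β))) with
    mul := fun x y => WithLp.toLp 1 (x.ofLp * y.ofLp)
    left_distrib := fun x y z => congrArg (WithLp.toLp 1) (mul_add x.ofLp y.ofLp z.ofLp)
    right_distrib := fun x y z => congrArg (WithLp.toLp 1) (add_mul x.ofLp y.ofLp z.ofLp)
    zero_mul := fun x => congrArg (WithLp.toLp 1) (zero_mul x.ofLp)
    mul_zero := fun x => congrArg (WithLp.toLp 1) (mul_zero x.ofLp)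
    mul_assoc := fun x y z => congrArg (WithLp.toLp 1) (mul_assoc x.ofLp y.ofLp z.ofLp) }

lemma norm_def (x : WithLp 1 (α × β)) : ‖x‖ = ‖x.fst‖ + ‖x.snd‖ := by
  rw [WithLp.prod_norm_eq_add (by norm_num)]
  norm_num

lemma mul_fst (x y : WithLp 1 (α × β)) : (x * y).fst = x.fst * y.fst := rfl
lemma mul_snd (x y : WithLp 1 (α × β)) : (x * y).snd = x.snd * y.snd := rfl

/-- The direct sum `A₁ ⊕ A₂` of two (non-unital) normed rings, i.e. the Cartesian product
with coordinatewise operations and the norm `‖(a₁, a₂)‖ = ‖a₁‖ + ‖a₂‖`, as a normed ring. -/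
noncomputable instance : NonUnitalNormedRing (WithLp 1 (α × β)) :=
  { (inferInstance : NormedAddCommGroup (WithLp 1 (α × β))),
    (inferInstance : NonUnitalRing (WithLp 1 (α × β))) with
    dist_eq := NormedAddCommGroup.dist_eq
    norm_mul_le := fun x y => by
      simp only [norm_def, mul_fst, mul_snd]
      have h1 : ‖x.fst * y.fst‖ + ‖x.snd * y.snd‖ ≤ ‖x.fst‖ * ‖y.fst‖ + ‖x.snd‖ * ‖y.snd‖ :=
        add_le_add (norm_mul_le _ _) (norm_mul_le _ _)
      refine h1.trans ?_
      nlinarith [norm_nonneg x.fst, norm_nonneg x.snd, norm_nonneg y.fst, norm_nonneg y.snd] }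

variable [NormedSpace ℂ α] [NormedSpace ℂ β]
  [IsScalarTower ℂ α α] [SMulCommClass ℂ α α] [IsScalarTower ℂ β β] [SMulCommClass ℂ β β]

noncomputable instance : IsScalarTower ℂ (WithLp 1 (α × β)) (WithLp 1 (α × β)) :=
  ⟨fun c x y => congrArg (WithLp.toLp 1) (smul_assoc c x.ofLp y.ofLp)⟩

noncomputable instance : SMulCommClass ℂ (WithLp 1 (α × β)) (WithLp 1 (α × β)) :=
  ⟨fun c x y => congrArg (WithLp.toLp 1) (smul_comm c x.ofLp y.ofLp)⟩

end L1Prod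

section

variable {A B : Type*} [NonUnitalNormedRing A] [NormedSpace ℂ A]
  [NonUnitalNormedRing B] [NormedSpace ℂ B]

theorem IsMulFunctional.comp {φ : A →L[ℂ] ℂ} (hφ : IsMulFunctional φ) (f : B →L[ℂ] A)
    (hf : ∀ a b, f (a * b) = f a * f b) : IsMulFunctional (φ.comp f) := fun a b => by
  simp [hf, hφ (f a) (f b)]

theorem IsPointDerivationAt.comp {φ d : A →L[ℂ] ℂ} (hd : IsPointDerivationAt φ d)
    (f : B →L[ℂ] A) (hf : ∀ a b, f (a * b) = f a * f b) :
    IsPointDerivationAt (φ.comp f) (d.comp f) := fun a b => by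
  simp [hf, hd (f a) (f b)]

/-- A quotient of a 0-point amenable algebra is 0-point amenable. -/
theorem ZeroPointAmenable.of_surjective (hB : ZeroPointAmenable B) (f : B →L[ℂ] A)
    (hf : ∀ a b, f (a * b) = f a * f b) (hsurj : Function.Surjective f) :
    ZeroPointAmenable A := by
  intro φ d hφ hd
  have h := hB _ _ (hφ.comp f hf) (hd.comp f hf)
  ext a
  obtain ⟨b, rfl⟩ := hsurj a
  exact congrArg (fun g : B →L[ℂ] ℂ => g b) h

/-- A point derivation vanishes on the image of a 0-point amenable algebra. -/
theorem ZeroPointAmenable.apply_eq_zero (hB : ZeroPointAmenable B) {φ d : A →L[ℂ] ℂ}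
    (hφ : IsMulFunctional φ) (hd : IsPointDerivationAt φ d) (f : B →L[ℂ] A)
    (hf : ∀ a b, f (a * b) = f a * f b) (b : B) : d (f b) = 0 :=
  congrArg (fun g : B →L[ℂ] ℂ => g b) (hB _ _ (hφ.comp f hf) (hd.comp f hf))

end

/-- The direct sum `A₁ ⊕ A₂` (with norm `‖(a₁,a₂)‖ = ‖a₁‖ + ‖a₂‖`) of two complex Banach
algebras is 0-point amenable if and only if both `A₁` and `A₂` are 0-point amenable. -/
theorem zeroPointAmenable_directSum_iff {A₁ A₂ : Type*}
    [NonUnitalNormedRing A₁] [NormedSpace ℂ A₁] [IsScalarTower ℂ A₁ A₁]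
    [SMulCommClass ℂ A₁ A₁] [CompleteSpace A₁]
    [NonUnitalNormedRing A₂] [NormedSpace ℂ A₂] [IsScalarTower ℂ A₂ A₂]
    [SMulCommClass ℂ A₂ A₂] [CompleteSpace A₂] :
    ZeroPointAmenable (WithLp 1 (A₁ × A₂)) ↔
      ZeroPointAmenable A₁ ∧ ZeroPointAmenable A₂ := by
  constructor
  · intro h
    exact ⟨h.of_surjective (WithLp.fstL 1 ℂ A₁ A₂)
        (fun _ _ => rfl) (fun a => ⟨WithLp.toLp 1 (a, 0), rfl⟩),
      h.of_surjective (WithLp.sndL 1 ℂ A₁ A₂)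
        (fun _ _ => rfl) (fun a => ⟨WithLp.toLp 1 (0, a), rfl⟩)⟩
  · rintro ⟨h₁, h₂⟩ φ d hφ hd
    ext x
    have hx : x = WithLp.toLp 1 (x.fst, 0) + WithLp.toLp 1 (0, x.snd) := by
      rw [← WithLp.toLp_add, Prod.mk_add_mk, add_zero, zero_add]
      rfl
    let e : A₁ × A₂ →L[ℂ] WithLp 1 (A₁ × A₂) :=
      (WithLp.prodContinuousLinearEquiv 1 ℂ A₁ A₂).symm
    have hx₁ : d (WithLp.toLp 1 (x.fst, 0)) = 0 :=
      h₁.apply_eq_zero hφ hd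
        (e.comp (ContinuousLinearMap.inl ℂ A₁ A₂))
        (fun a b => congrArg (WithLp.toLp 1)
          (by simp : ((a * b, 0) : A₁ × A₂) = (a, 0) * (b, 0))) x.fst
    have hx₂ : d (WithLp.toLp 1 (0, x.snd)) = 0 :=
      h₂.apply_eq_zero hφ hd
        (e.comp (ContinuousLinearMap.inr ℂ A₁ A₂))
        (fun a b => congrArg (WithLp.toLp 1)
          (by simp : ((0, a * b) : A₁ × A₂) = (0, a) * (0, b))) x.snd
    rw [hx, map_add, hx₁, hx₂, add_zero, zero_apply]
end

section
/- Let A₁ and A₂ be complex Banach algebras and let A₁ ⊕ A₂ denote their direct sum, the Banach algebra on the Cartesian product with coordinatewise operations and norm ‖(a₁,a₂)‖ = ‖a₁‖ + ‖a₂‖. Then A₁ ⊕ A₂ is weakly amenable if and only if both A₁ and A₂ are weakly amenable. -/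
section

variable {A B : Type*} [NonUnitalNormedRing A] [NormedSpace ℂ A]
  [NonUnitalNormedRing B] [NormedSpace ℂ B]

/-- Derivations pull back along multiplicative continuous linear maps. -/
theorem IsDerivation.bilinearComp {D : B →L[ℂ] (B →L[ℂ] ℂ)} (hD : IsDerivation D)
    (φ : A →L[ℂ] B) (hφ : ∀ a b, φ (a * b) = φ a * φ b) :
    IsDerivation (D.bilinearComp φ φ) := fun a b x => by
  simp only [ContinuousLinearMap.bilinearComp_apply, hφ]
  exact hD _ _ _

/-- Weak amenability passes to retracts. -/
theorem WeaklyAmenable.of_retract (hB : WeaklyAmenable B) (ι : A →L[ℂ] B) (π : B →L[ℂ] A)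
    (hι : ∀ a b, ι (a * b) = ι a * ι b) (hπ : ∀ a b, π (a * b) = π a * π b)
    (hπι : ∀ a, π (ι a) = a) : WeaklyAmenable A := fun D hD => by
  obtain ⟨F, hF⟩ := hB _ (hD.bilinearComp π hπ)
  refine ⟨F.comp ι, fun a x => ?_⟩
  simpa [hπι, hι] using hF (ι a) (ι x)

/-- A continuous functional on a weakly amenable algebra that kills all products is zero:
otherwise `a ↦ f a • f` would be a derivation that is not inner. -/
theorem WeaklyAmenable.eq_zero_of_mul_eq_zero (hA : WeaklyAmenable A) (f : A →L[ℂ] ℂ)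
    (hf : ∀ a b, f (a * b) = 0) : f = 0 := by
  obtain ⟨F, hF⟩ := hA (f.smulRight f) fun a b x => by simp [hf]
  ext a
  simpa using hF a a

end

namespace L1Prod

variable (α β : Type*) [NonUnitalNormedRing α] [NonUnitalNormedRing β]
  [NormedSpace ℂ α] [NormedSpace ℂ β]

/-- The inclusion of the first summand. -/
noncomputable def inl : α →L[ℂ] WithLp 1 (α × β) :=
  (WithLp.prodContinuousLinearEquiv 1 ℂ α β).symm.toContinuousLinearMap.comp
    (ContinuousLinearMap.inl ℂ α β)

/-- The inclusion of the second summand. -/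
noncomputable def inr : β →L[ℂ] WithLp 1 (α × β) :=
  (WithLp.prodContinuousLinearEquiv 1 ℂ α β).symm.toContinuousLinearMap.comp
    (ContinuousLinearMap.inr ℂ α β)

variable {α β}

lemma inl_mul (a b : α) : inl α β (a * b) = inl α β a * inl α β b :=
  congrArg (WithLp.toLp 1) (Prod.ext rfl (mul_zero (0 : β)).symm)

lemma inr_mul (a b : β) : inr α β (a * b) = inr α β a * inr α β b :=
  congrArg (WithLp.toLp 1) (Prod.ext (mul_zero (0 : α)).symm rfl)

lemma inl_mul_inr (a : α) (b : β) : inl α β a * inr α β b = 0 :=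
  congrArg (WithLp.toLp 1) (Prod.ext (mul_zero a) (zero_mul b))

lemma inr_mul_inl (b : β) (a : α) : inr α β b * inl α β a = 0 :=
  congrArg (WithLp.toLp 1) (Prod.ext (zero_mul a) (mul_zero b))

lemma inl_fst_add_inr_snd (x : WithLp 1 (α × β)) : inl α β x.fst + inr α β x.snd = x :=
  congrArg (WithLp.toLp 1) (Prod.ext (add_zero x.fst) (zero_add x.snd))

end L1Prod

/-- A derivation on the image of a weakly amenable algebra vanishes at every element which
annihilates that image on both sides. -/
theorem IsDerivation.apply_eq_zero_of_orthogonal {A B : Type*}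
    [NonUnitalNormedRing A] [NormedSpace ℂ A]
    [NonUnitalNormedRing B] [NormedSpace ℂ B] {D : B →L[ℂ] (B →L[ℂ] ℂ)} (hD : IsDerivation D)
    (hA : WeaklyAmenable A) (φ : A →L[ℂ] B) (hφ : ∀ a b, φ (a * b) = φ a * φ b)
    (y : B) (hl : ∀ a, φ a * y = 0) (hr : ∀ a, y * φ a = 0) (a : A) : D (φ a) y = 0 := by
  have h := hA.eq_zero_of_mul_eq_zero ((D.comp φ).flip y) fun a b => by
    simp [hφ, hD (φ a) (φ b) y, hl, hr]
  exact DFunLike.congr_fun h a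

/-- The direct sum `A₁ ⊕ A₂` (with norm `‖(a₁,a₂)‖ = ‖a₁‖ + ‖a₂‖`) of two complex Banach
algebras is weakly amenable iff both `A₁` and `A₂` are. -/
theorem weaklyAmenable_directSum_iff {A₁ A₂ : Type*}
    [NonUnitalNormedRing A₁] [NormedSpace ℂ A₁] [IsScalarTower ℂ A₁ A₁]
    [SMulCommClass ℂ A₁ A₁] [CompleteSpace A₁]
    [NonUnitalNormedRing A₂] [NormedSpace ℂ A₂] [IsScalarTower ℂ A₂ A₂]
    [SMulCommClass ℂ A₂ A₂] [CompleteSpace A₂] :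
    WeaklyAmenable (WithLp 1 (A₁ × A₂)) ↔
      WeaklyAmenable A₁ ∧ WeaklyAmenable A₂ := by
  refine ⟨fun h => ⟨?_, ?_⟩, fun ⟨h₁, h₂⟩ D hD => ?_⟩
  · exact h.of_retract (L1Prod.inl A₁ A₂) (WithLp.fstL 1 ℂ A₁ A₂) L1Prod.inl_mul
      (fun _ _ => rfl) fun _ => rfl
  · exact h.of_retract (L1Prod.inr A₁ A₂) (WithLp.sndL 1 ℂ A₁ A₂) L1Prod.inr_mul
      (fun _ _ => rfl) fun _ => rfl
  · obtain ⟨F, hF⟩ := h₁ _ (hD.bilinearComp (L1Prod.inl A₁ A₂) L1Prod.inl_mul)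
    obtain ⟨G, hG⟩ := h₂ _ (hD.bilinearComp (L1Prod.inr A₁ A₂) L1Prod.inr_mul)
    simp only [ContinuousLinearMap.bilinearComp_apply] at hF hG
    have hlr (a : A₁) (b : A₂) : D (L1Prod.inl A₁ A₂ a) (L1Prod.inr A₁ A₂ b) = 0 :=
      hD.apply_eq_zero_of_orthogonal h₁ _ L1Prod.inl_mul _
        (fun a => L1Prod.inl_mul_inr a b) (fun a => L1Prod.inr_mul_inl b a) a
    have hrl (b : A₂) (a : A₁) : D (L1Prod.inr A₁ A₂ b) (L1Prod.inl A₁ A₂ a) = 0 :=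
      hD.apply_eq_zero_of_orthogonal h₂ _ L1Prod.inr_mul _
        (fun b => L1Prod.inr_mul_inl b a) (fun b => L1Prod.inl_mul_inr a b) b
    refine ⟨F.comp (WithLp.fstL 1 ℂ A₁ A₂) + G.comp (WithLp.sndL 1 ℂ A₁ A₂), fun a x => ?_⟩
    conv_lhs => rw [← L1Prod.inl_fst_add_inr_snd a, ← L1Prod.inl_fst_add_inr_snd x]
    simp only [map_add, add_apply,
      ContinuousLinearMap.comp_apply, hF, hG, hlr, hrl,
      WithLp.fstL_apply, WithLp.sndL_apply, L1Prod.mul_fst, L1Prod.mul_snd]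
    ring
end
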